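/- Let n : ℕ → ℕ be strictly monotone and for each k let G k be a connected simple graph on Fin (n k), such that the graphs G k are pairwise orbitally similar (a self-similar sequence). Then the standard density dens(G k) := (2 * (G k).edgeFinset.card : ℝ) / (n k * (n k - 1)) is strictly decreasing in k and tends to 0 as k → ∞. -/

import Mathlib

open Classical Finset

/-- `O : Fin ℓ → Finset V` is an orbit enumeration of the graph `G`:
every vertex lies in exactly one `O i`, and each `O i` is an orbit of the
automorphism group of `G` acting on the vertices. -/
def IsOrbitEnum {V : Type*} (G : SimpleGraph V) {ℓ : ℕ} (O : Fin ℓ → Finset V) : Prop :=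
  (∀ v : V, ∃! i, v ∈ O i) ∧
  ∀ i : Fin ℓ, ∃ w : V, ∀ v : V, v ∈ O i ↔ ∃ φ : G ≃g G, φ w = v

/-- `S` is the orbit divisor matrix of `G` relative to the orbit enumeration `O`:
for every vertex `u ∈ O i`, the number of vertices of `O j` adjacent to `u` is `S i j`. -/
def IsOrbitDivisorMatrix {V : Type*} (G : SimpleGraph V) {ℓ : ℕ}
    (O : Fin ℓ → Finset V) (S : Matrix (Fin ℓ) (Fin ℓ) ℕ) : Prop :=
  ∀ i j : Fin ℓ, ∀ u ∈ O i, ((O j).filter fun v => G.Adj u v).card = S i j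

/-- Two graphs are orbitally similar if they admit orbit enumerations with a
common orbit divisor matrix. -/
def OrbitallySimilar {V W : Type*} (G : SimpleGraph V) (H : SimpleGraph W) : Prop :=
  ∃ (ℓ : ℕ) (O : Fin ℓ → Finset V) (Q : Fin ℓ → Finset W) (S : Matrix (Fin ℓ) (Fin ℓ) ℕ),
    IsOrbitEnum G O ∧ IsOrbitEnum H Q ∧
    IsOrbitDivisorMatrix G O S ∧ IsOrbitDivisorMatrix H Q S

namespace IsOrbitEnum

variable {V : Type*} {G : SimpleGraph V} {ℓ : ℕ} {O : Fin ℓ → Finset V}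

theorem nonempty (hO : IsOrbitEnum G O) (i : Fin ℓ) : (O i).Nonempty := by
  obtain ⟨w, hw⟩ := hO.2 i
  exact ⟨w, (hw w).2 ⟨RelIso.refl _, rfl⟩⟩

/-- Summing over all vertices amounts to summing over each orbit in turn. -/
theorem sum_eq [Fintype V] (hO : IsOrbitEnum G O) (f : V → ℕ) :
    ∑ v, f v = ∑ i, ∑ v ∈ O i, f v := by
  choose c hc hu using hO.1
  have hfilter : ∀ i, O i = univ.filter fun v => c v = i := by
    intro i
    ext v
    simp only [mem_filter, mem_univ, true_and]
    exact ⟨fun h => (hu v i h).symm, fun h => h ▸ hc v⟩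
  simp_rw [hfilter]
  exact (Finset.sum_fiberwise univ c f).symm

theorem card_eq [Fintype V] (hO : IsOrbitEnum G O) :
    Fintype.card V = ∑ i, (O i).card := by
  simpa using hO.sum_eq fun _ => 1

theorem two_mul_card_edgeFinset [Fintype V] [DecidableRel G.Adj] (hO : IsOrbitEnum G O)
    {S : Matrix (Fin ℓ) (Fin ℓ) ℕ} (hS : IsOrbitDivisorMatrix G O S) :
    2 * G.edgeFinset.card = ∑ i, (O i).card * ∑ j, S i j := by
  rw [← G.sum_degrees_eq_twice_card_edges, hO.sum_eq]
  refine Finset.sum_congr rfl fun i _ => ?_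
  rw [← smul_eq_mul, ← Finset.sum_const]
  refine Finset.sum_congr rfl fun u hu => ?_
  rw [← G.card_neighborFinset_eq_degree, SimpleGraph.neighborFinset_eq_filter,
    Finset.card_filter, hO.sum_eq]
  refine Finset.sum_congr rfl fun j _ => ?_
  rw [← Finset.card_filter, ← hS i j u hu]
  congr!

end IsOrbitEnum

/-- Counting the edges between two orbits from both sides. -/
theorem IsOrbitDivisorMatrix.card_mul_eq {V : Type*} {G : SimpleGraph V} {ℓ : ℕ}
    {O : Fin ℓ → Finset V} {S : Matrix (Fin ℓ) (Fin ℓ) ℕ}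
    (hS : IsOrbitDivisorMatrix G O S) (i j : Fin ℓ) :
    (O i).card * S i j = (O j).card * S j i := by
  refine Finset.card_mul_eq_card_mul G.Adj (fun u hu => ?_) fun v hv => ?_
  · exact hS i j u hu
  · rw [← hS j i v hv]
    simp only [Finset.bipartiteBelow, G.adj_comm]

/-- If `G` is connected, then the orbit sizes of `G` are proportional to those of any graph
with the same orbit divisor matrix. -/
theorem exists_card_orbit_eq_mul {V W : Type*} {G : SimpleGraph V} {H : SimpleGraph W}
    (hG : G.Connected) {ℓ : ℕ} {O : Fin ℓ → Finset V} {Q : Fin ℓ → Finset W}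
    {S : Matrix (Fin ℓ) (Fin ℓ) ℕ} (hO : IsOrbitEnum G O) (hQ : IsOrbitEnum H Q)
    (hSO : IsOrbitDivisorMatrix G O S) (hSQ : IsOrbitDivisorMatrix H Q S) :
    ∃ r : ℝ, ∀ i, ((O i).card : ℝ) = r * (Q i).card := by
  choose c hc hu using hO.1
  have hQpos : ∀ i, (0 : ℝ) < (Q i).card := fun i => by exact_mod_cast (hQ.nonempty i).card_pos
  let ratio : V → ℝ := fun v => (O (c v)).card / (Q (c v)).card
  have hadj : ∀ u v, G.Adj u v → ratio u = ratio v := by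
    intro u v huv
    have hS : 0 < S (c v) (c u) := by
      rw [← hSO (c v) (c u) v (hc v)]
      exact Finset.card_pos.2 ⟨u, Finset.mem_filter.2 ⟨hc u, huv.symm⟩⟩
    have hS' : (0 : ℝ) < S (c v) (c u) := by exact_mod_cast hS
    have h1 : ((O (c u)).card : ℝ) * S (c u) (c v) = (O (c v)).card * S (c v) (c u) := by
      exact_mod_cast hSO.card_mul_eq (c u) (c v)
    have h2 : ((Q (c u)).card : ℝ) * S (c u) (c v) = (Q (c v)).card * S (c v) (c u) := by
      exact_mod_cast hSQ.card_mul_eq (c u) (c v)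
    rw [div_eq_div_iff (hQpos _).ne' (hQpos _).ne']
    apply mul_right_cancel₀ hS'.ne'
    linear_combination (Q (c u)).card * h1 - (O (c u)).card * h2
  have hwalk : ∀ u v, G.Walk u v → ratio u = ratio v := by
    intro u v p
    induction p with
    | nil => rfl
    | cons h _ ih => exact (hadj _ _ h).trans ih
  obtain ⟨v₀⟩ := hG.nonempty
  refine ⟨ratio v₀, fun i => ?_⟩
  obtain ⟨v, hv⟩ := hO.nonempty i
  obtain ⟨p⟩ := hG.preconnected v₀ v
  rw [hwalk v₀ v p, hu v i hv]
  exact (div_mul_cancel₀ _ (hQpos _).ne').symm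

/-- Orbitally similar graphs, one of which is connected, have the same average degree. -/
theorem OrbitallySimilar.two_mul_card_edgeFinset_mul_card {V W : Type*} [Fintype V] [Fintype W]
    {G : SimpleGraph V} {H : SimpleGraph W} [DecidableRel G.Adj] [DecidableRel H.Adj]
    (hG : G.Connected) (h : OrbitallySimilar G H) :
    (2 * G.edgeFinset.card : ℝ) * Fintype.card W =
      (2 * H.edgeFinset.card : ℝ) * Fintype.card V := by
  obtain ⟨ℓ, O, Q, S, hO, hQ, hSO, hSQ⟩ := h
  obtain ⟨r, hr⟩ := exists_card_orbit_eq_mul hG hO hQ hSO hSQ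
  have hcard : (Fintype.card V : ℝ) = r * Fintype.card W := by
    rw [hO.card_eq, hQ.card_eq]
    push_cast
    rw [Finset.mul_sum]
    exact Finset.sum_congr rfl fun i _ => hr i
  have hG2 : (2 * G.edgeFinset.card : ℝ) = ∑ i, ((O i).card : ℝ) * ∑ j, (S i j : ℝ) := by
    exact_mod_cast hO.two_mul_card_edgeFinset hSO
  have hH2 : (2 * H.edgeFinset.card : ℝ) = ∑ i, ((Q i).card : ℝ) * ∑ j, (S i j : ℝ) := by
    exact_mod_cast hQ.two_mul_card_edgeFinset hSQ
  have hedge : (2 * G.edgeFinset.card : ℝ) = r * (2 * H.edgeFinset.card) := by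
    rw [hG2, hH2, Finset.mul_sum]
    refine Finset.sum_congr rfl fun i _ => ?_
    rw [hr i, mul_assoc]
  rw [hcard, hedge]
  ring

/-- A connected graph on at least two vertices has an edge. -/
theorem SimpleGraph.Connected.card_edgeFinset_pos {V : Type*} [Fintype V] {G : SimpleGraph V}
    [DecidableRel G.Adj] (hG : G.Connected) (hV : 1 < Fintype.card V) :
    0 < G.edgeFinset.card := by
  have := hG.card_vert_le_card_edgeSet_add_one
  rw [Nat.card_eq_fintype_card, Nat.card_eq_fintype_card, ← SimpleGraph.edgeFinset_card] at this
  omega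

/-- Along a self-similar sequence of connected graphs, the standard density
`2e/(n(n-1))` is strictly decreasing and tends to `0`. -/
theorem density_strictAnti_tendsto_zero (n : ℕ → ℕ) (hn : StrictMono n)
    (G : ∀ k : ℕ, SimpleGraph (Fin (n k))) [∀ k : ℕ, DecidableRel (G k).Adj]
    (hconn : ∀ k : ℕ, (G k).Connected)
    (hsim : ∀ k l : ℕ, k ≠ l → OrbitallySimilar (G k) (G l)) :
    StrictAnti (fun k : ℕ =>
        (2 * (G k).edgeFinset.card : ℝ) / ((n k : ℝ) * ((n k : ℝ) - 1))) ∧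
      Filter.Tendsto (fun k : ℕ =>
          (2 * (G k).edgeFinset.card : ℝ) / ((n k : ℝ) * ((n k : ℝ) - 1)))
        Filter.atTop (nhds 0) := by
  have hpos : ∀ k, 0 < n k := fun k => by
    obtain ⟨v⟩ := (hconn k).nonempty
    exact v.pos
  obtain ⟨d, hd⟩ : ∃ d : ℝ, ∀ k, (2 * (G k).edgeFinset.card : ℝ) = d * n k := by
    refine ⟨2 * (G 0).edgeFinset.card / n 0, fun k => ?_⟩
    have h0 : (n 0 : ℝ) ≠ 0 := by exact_mod_cast (hpos 0).ne'
    rw [div_mul_eq_mul_div, eq_div_iff h0]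
    rcases eq_or_ne k 0 with rfl | hk
    · rfl
    · simpa using (hsim k 0 hk).two_mul_card_edgeFinset_mul_card (hconn k)
  have hd0 : 0 < d := by
    have h1 : 0 < (G 1).edgeFinset.card := by
      refine (hconn 1).card_edgeFinset_pos ?_
      rw [Fintype.card_fin]
      exact Nat.lt_of_le_of_lt (hpos 0) (hn zero_lt_one)
    have h2 : (0 : ℝ) < d * n 1 := by
      rw [← hd 1]
      positivity
    exact pos_of_mul_pos_left h2 (Nat.cast_nonneg _)
  have hn0 : 1 < n 0 := by
    by_contra hle
    have h0 : n 0 = 1 := by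
      have := hpos 0
      omega
    have hbot : (G 0).edgeFinset.card = 0 := by
      have := (G 0).card_edgeFinset_le_card_choose_two
      rw [Fintype.card_fin, show (n 0).choose 2 = 0 by rw [h0]; rfl] at this
      exact Nat.le_zero.1 this
    have h2 := hd 0
    have h3 : (0 : ℝ) < n 0 := by exact_mod_cast hpos 0
    rw [hbot, Nat.cast_zero, mul_zero] at h2
    exact (mul_pos hd0 h3).ne h2
  have hn1 : ∀ k, (0 : ℝ) < (n k : ℝ) - 1 := fun k => by
    have : 1 < n k := hn0.trans_le (hn.monotone k.zero_le)
    have : (1 : ℝ) < n k := by exact_mod_cast this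
    linarith
  have hdens : (fun k : ℕ =>
      (2 * (G k).edgeFinset.card : ℝ) / ((n k : ℝ) * ((n k : ℝ) - 1))) =
      fun k => d / ((n k : ℝ) - 1) := by
    funext k
    have hk : (n k : ℝ) ≠ 0 := by exact_mod_cast (hpos k).ne'
    rw [hd k, mul_comm d, mul_div_mul_left _ _ hk]
  rw [hdens]
  refine ⟨fun k l hkl => ?_, ?_⟩
  · have : (n k : ℝ) < n l := by exact_mod_cast hn hkl
    exact div_lt_div_of_pos_left hd0 (hn1 k) (by linarith)
  · refine Filter.Tendsto.const_div_atTop ?_ d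
    exact Filter.tendsto_atTop_add_const_right _ (-1)
      (tendsto_natCast_atTop_atTop.comp hn.tendsto_atTop)
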